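/- Let b > 0 and let (b_j)_{j≥1} be a nonincreasing summable sequence of nonnegative reals with b_1 + b_2 ≤ b, ∑_j b_j ≤ 3b and ∑_j b_j² < b². Define cB(a,k) := a · min{d ∈ ℕ : d² + 3d ≥ 2k} for a ≥ 0 and k ∈ ℕ, and define c_k := inf over finitely supported functions κ : ℕ → ℕ of [cB(b, k + ∑_j κ(j)) − ∑_j cB(b_j, κ(j))]. Set Vol := b² − ∑_j b_j² and Per := 3b − ∑_j b_j. Then liminf_{k→∞} (c_k − √(2k·Vol)) ≤ −Per/2. -/

import Mathlib

open Filter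

/-- The `k`-th ECH capacity of the ball `B(a)`: `cB a k = a * min {d ∈ ℕ | d² + 3d ≥ 2k}`. -/
noncomputable def cB (a : ℝ) (k : ℕ) : ℝ :=
  a * (sInf {d : ℕ | 2 * k ≤ d ^ 2 + 3 * d} : ℕ)

/-- The `k`-th ECH capacity of the convex toric domain with negative weight data
`(b; (bj j))`: the infimum over finitely supported `κ : ℕ → ℕ` of
`cB b (k + ∑ κ j) − ∑ cB (bj j) (κ j)`. -/
noncomputable def toricCap (b : ℝ) (bj : ℕ → ℝ) (k : ℕ) : ℝ :=
  ⨅ κ : ℕ →₀ ℕ,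
    (cB b (k + ∑ j ∈ κ.support, κ j) - ∑ j ∈ κ.support, cB (bj j) (κ j))

/-- The least `d` with `d² + 3d ≥ 2k`. -/
noncomputable def ballIndex (k : ℕ) : ℕ := sInf {d : ℕ | 2 * k ≤ d ^ 2 + 3 * d}

theorem cB_eq (a : ℝ) (k : ℕ) : cB a k = a * (ballIndex k : ℝ) := rfl

theorem nonempty_ballIndex (k : ℕ) : {d : ℕ | 2 * k ≤ d ^ 2 + 3 * d}.Nonempty :=
  ⟨k, by show 2 * k ≤ k ^ 2 + 3 * k; nlinarith⟩

theorem ballIndex_spec (k : ℕ) : 2 * k ≤ ballIndex k ^ 2 + 3 * ballIndex k :=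
  Nat.sInf_mem (nonempty_ballIndex k)

theorem ballIndex_le {k d : ℕ} (h : 2 * k ≤ d ^ 2 + 3 * d) : ballIndex k ≤ d :=
  Nat.sInf_le h

theorem le_ballIndex {k d : ℕ} (h : d ^ 2 + d ≤ 2 * k) : d ≤ ballIndex k := by
  have hs := ballIndex_spec k
  by_contra! hlt
  nlinarith

theorem ballIndex_sq_le (k : ℕ) : ballIndex k ^ 2 ≤ 2 * k := by
  by_contra! hlt
  rcases Nat.eq_zero_or_pos (ballIndex k) with h0 | hpos
  · simp [h0] at hlt
  · obtain ⟨e, he⟩ : ∃ e, ballIndex k = e + 1 := ⟨ballIndex k - 1, by omega⟩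
    have : ballIndex k ≤ e := ballIndex_le (by rw [he] at hlt; nlinarith)
    omega

theorem sqrt_le_ballIndex_add (k : ℕ) : √(2 * k) ≤ ballIndex k + 3 / 2 := by
  have h : (2 * k : ℝ) ≤ (ballIndex k : ℝ) ^ 2 + 3 * ballIndex k := by
    exact_mod_cast ballIndex_spec k
  exact Real.sqrt_le_iff.2 ⟨by positivity, by nlinarith⟩

theorem ballIndex_le_sqrt (k : ℕ) : (ballIndex k : ℝ) ≤ √(2 * k) :=
  Real.le_sqrt_of_sq_le (by exact_mod_cast ballIndex_sq_le k)

theorem sqrt_mul_add_sqrt_mul_le {p q x y : ℝ} (hp : 0 ≤ p) (hq : 0 ≤ q) (hx : 0 ≤ x)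
    (hy : 0 ≤ y) : √x * √p + √q * √y ≤ √(p + q) * √(x + y) := by
  rw [← Real.sqrt_mul (add_nonneg hp hq)]
  apply Real.le_sqrt_of_sq_le
  nlinarith [Real.sq_sqrt hp, Real.sq_sqrt hq, Real.sq_sqrt hx, Real.sq_sqrt hy,
    sq_nonneg (√x * √q - √p * √y), mul_pow (√x) (√p) 2, mul_pow (√q) (√y) 2,
    mul_pow (√x) (√q) 2, mul_pow (√p) (√y) 2]

theorem sqrt_vol_sub_le {b : ℝ} (hb : 0 < b) {bj : ℕ → ℝ} (hnonneg : ∀ j, 0 ≤ bj j)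
    (hs2 : Summable fun j => bj j ^ 2) (hsq : ∑' j, bj j ^ 2 < b ^ 2) (k : ℕ) (κ : ℕ →₀ ℕ) :
    √(2 * k * (b ^ 2 - ∑' j, bj j ^ 2)) - 3 / 2 * b ≤
      cB b (k + ∑ j ∈ κ.support, κ j) - ∑ j ∈ κ.support, cB (bj j) (κ j) := by
  set S := ∑' j, bj j ^ 2 with hS
  set K := ∑ j ∈ κ.support, κ j with hK
  have hS0 : 0 ≤ S := tsum_nonneg fun j => sq_nonneg _
  have hbig : b * √(2 * k + 2 * K) - 3 / 2 * b ≤ cB b (k + K) := by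
    have := sqrt_le_ballIndex_add (k + K)
    rw [cB_eq]
    push_cast at this
    rw [mul_add] at this
    nlinarith
  have hsmall : ∑ j ∈ κ.support, cB (bj j) (κ j) ≤ √S * √(2 * K) := by
    calc ∑ j ∈ κ.support, cB (bj j) (κ j)
        ≤ ∑ j ∈ κ.support, bj j * √(2 * κ j) := Finset.sum_le_sum fun j _ =>
          mul_le_mul_of_nonneg_left (ballIndex_le_sqrt _) (hnonneg j)
      _ ≤ √(∑ j ∈ κ.support, bj j ^ 2) * √(∑ j ∈ κ.support, √(2 * κ j) ^ 2) :=
          Real.sum_mul_le_sqrt_mul_sqrt _ _ _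
      _ ≤ √S * √(2 * K) := by
          gcongr
          · exact hs2.sum_le_tsum _ fun j _ => sq_nonneg _
          · apply le_of_eq
            rw [hK]
            push_cast
            rw [Finset.mul_sum]
            exact Finset.sum_congr rfl fun j _ => Real.sq_sqrt (by positivity)
  have hcs := sqrt_mul_add_sqrt_mul_le (p := b ^ 2 - S) (q := S) (x := 2 * k) (y := 2 * K)
    (by linarith) hS0 (by positivity) (by positivity)
  rw [sub_add_cancel, Real.sqrt_sq hb.le, ← Real.sqrt_mul (by positivity)] at hcs
  linarith

theorem toricCap_le {b : ℝ} (hb : 0 < b) {bj : ℕ → ℝ} (hnonneg : ∀ j, 0 ≤ bj j)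
    (hs2 : Summable fun j => bj j ^ 2) (hsq : ∑' j, bj j ^ 2 < b ^ 2) {κ : ℕ →₀ ℕ} {m : ℕ → ℕ}
    (hκ : ∀ j, 2 * κ j = m j ^ 2 + m j) {k d : ℕ}
    (hk : 2 * (k + ∑ j ∈ κ.support, κ j) = d ^ 2 + 3 * d) :
    toricCap b bj k ≤ b * d - ∑ j ∈ κ.support, bj j * (m j : ℝ) := by
  calc toricCap b bj k
      ≤ cB b (k + ∑ j ∈ κ.support, κ j) - ∑ j ∈ κ.support, cB (bj j) (κ j) := by
        refine ciInf_le ⟨√(2 * k * (b ^ 2 - ∑' j, bj j ^ 2)) - 3 / 2 * b, ?_⟩ κ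
        rintro _ ⟨κ', rfl⟩
        exact sqrt_vol_sub_le hb hnonneg hs2 hsq k κ'
    _ ≤ b * d - ∑ j ∈ κ.support, bj j * (m j : ℝ) := by
        refine sub_le_sub ?_ (Finset.sum_le_sum fun j _ => ?_)
        · rw [cB_eq]
          gcongr
          exact ballIndex_le hk.le
        · rw [cB_eq]
          exact mul_le_mul_of_nonneg_left (by exact_mod_cast le_ballIndex (hκ j).ge) (hnonneg j)

theorem sq_le_mul_of_le {n V L M Q ε e : ℝ} (hV : 0 ≤ V) (hL : |L| ≤ M) (he : -3 ≤ e)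
    (hn : 3 * V + (|Q / 2 - ε| + M) ^ 2 ≤ n * (2 * V * ε)) :
    (n * V - L + (Q / 2 - ε)) ^ 2 ≤ (n ^ 2 * V - 2 * n * L + n * Q + e) * V := by
  have hc : (Q / 2 - ε - L) ^ 2 ≤ (|Q / 2 - ε| + M) ^ 2 :=
    sq_le_sq.2 (((abs_sub _ _).trans (by gcongr)).trans (le_abs_self _))
  have hrest : -3 * V ≤ e * V := mul_le_mul_of_nonneg_right he hV
  linarith

theorem exists_toricCap_sub_sqrt_le {b : ℝ} (hb : 0 < b) {bj : ℕ → ℝ}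
    (hnonneg : ∀ j, 0 ≤ bj j) (hsum : Summable bj) (hs2 : Summable fun j => bj j ^ 2)
    (hsq : ∑' j, bj j ^ 2 < b ^ 2) {ε : ℝ} (hε : 0 < ε) (N : ℕ) :
    ∃ k ≥ N, toricCap b bj k - √(2 * k * (b ^ 2 - ∑' j, bj j ^ 2)) ≤
      -(3 * b - ∑' j, bj j) / 2 + ε := by
  set S := ∑' j, bj j ^ 2 with hS
  set P := ∑' j, bj j with hP
  set V := b ^ 2 - S with hV
  have hV0 : 0 < V := by linarith
  have hP0 : 0 ≤ P := tsum_nonneg hnonneg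
  obtain ⟨n, hn1, hnk, hnε⟩ : ∃ n : ℕ, 1 ≤ n ∧
      2 * (b + P) + |3 * b - P| + 3 + 2 * N ≤ n * V ∧
      3 * V + (|(3 * b - P) / 2 - ε| + (b + P)) ^ 2 ≤ n * (2 * V * ε) := by
    have h1 := tendsto_natCast_atTop_atTop (R := ℝ) |>.atTop_mul_const hV0
    have h2 := tendsto_natCast_atTop_atTop (R := ℝ) |>.atTop_mul_const
      (show 0 < 2 * V * ε by positivity)
    exact ((eventually_ge_atTop 1).and ((h1.eventually_ge_atTop _).and
      (h2.eventually_ge_atTop _))).exists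
  have hn1' : (1 : ℝ) ≤ n := by exact_mod_cast hn1
  -- rounding errors of `n • (b; bj)`
  set d := ⌊n * b⌋₊ with hd
  set m : ℕ → ℕ := fun j => ⌊n * bj j⌋₊ with hm
  set r : ℝ := n * b - d with hr
  set s : ℕ → ℝ := fun j => n * bj j - m j with hs
  have hr0 : 0 ≤ r := sub_nonneg.2 (Nat.floor_le (by positivity))
  have hr1 : r ≤ 1 := by linarith [Nat.lt_floor_add_one (n * b)]
  have hs0 (j) : 0 ≤ s j :=
    sub_nonneg.2 (Nat.floor_le (mul_nonneg (by positivity) (hnonneg j)))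
  have hs1 (j) : s j ≤ 1 := by
    have := Nat.lt_floor_add_one (n * bj j)
    simp only [hs, hm]
    linarith
  have hnb : Summable fun j => n * bj j := hsum.mul_left _
  have hsS : Summable s := hnb.of_nonneg_of_le hs0 fun j => by simp [hs]
  have hs2S : Summable fun j => s j ^ 2 :=
    hsS.of_nonneg_of_le (fun j => sq_nonneg _) fun j => by nlinarith [hs0 j, hs1 j]
  have hbsS : Summable fun j => bj j * s j :=
    hsum.of_nonneg_of_le (fun j => mul_nonneg (hnonneg j) (hs0 j)) fun j => by
      nlinarith [hs0 j, hs1 j, hnonneg j]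
  have hmfin : (Function.support fun j => m j * (m j + 1) / 2).Finite := by
    have := hnb.tendsto_cofinite_zero.eventually (gt_mem_nhds one_pos)
    refine (Filter.eventually_cofinite.1 this).subset fun j hj hlt => hj ?_
    simp [hm, Nat.floor_eq_zero.2 hlt]
  obtain ⟨κ, hκ⟩ : ∃ κ : ℕ →₀ ℕ, ∀ j, 2 * κ j = m j ^ 2 + m j :=
    ⟨Finsupp.ofSupportFinite _ hmfin, fun j => by
      rw [Finsupp.ofSupportFinite_coe, Nat.mul_div_cancel' (Nat.even_mul_succ_self _).two_dvd]
      ring⟩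
  have hm0 {j} (hj : j ∉ κ.support) : m j = 0 := by
    have := hκ j
    rw [Finsupp.notMem_support_iff.1 hj] at this
    nlinarith
  set K := ∑ j ∈ κ.support, κ j with hK
  obtain ⟨D, hD⟩ : ∃ D, 2 * D = d ^ 2 + 3 * d := by
    obtain ⟨D, hD⟩ := (Nat.even_mul_succ_self d).two_dvd
    exact ⟨D + d, by linarith⟩
  set L := b * r - ∑' j, bj j * s j with hL
  have hbs0 : 0 ≤ ∑' j, bj j * s j := tsum_nonneg fun j => mul_nonneg (hnonneg j) (hs0 j)
  have hbsP : ∑' j, bj j * s j ≤ P := hbsS.tsum_le_tsum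
    (fun j => by nlinarith [hs0 j, hs1 j, hnonneg j]) hsum
  have hLabs : |L| ≤ b + P := abs_le.2 ⟨by nlinarith, by nlinarith⟩
  have hss : ∑' j, s j ^ 2 ≤ ∑' j, s j := hs2S.tsum_le_tsum
    (fun j => by nlinarith [hs0 j, hs1 j]) hsS
  have hKreal : (2 * K : ℝ) = n ^ 2 * S - 2 * n * ∑' j, bj j * s j + ∑' j, s j ^ 2
      + n * P - ∑' j, s j := by
    have h1 : (2 * K : ℝ) = ∑' j, ((m j : ℝ) ^ 2 + m j) := by
      rw [tsum_eq_sum (s := κ.support) fun j hj => by simp [hm0 hj], hK]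
      push_cast
      rw [Finset.mul_sum]
      exact Finset.sum_congr rfl fun j _ => by exact_mod_cast hκ j
    rw [h1]
    rw [hS, hP, ← tsum_mul_left, ← tsum_mul_left, ← tsum_mul_left,
      ← (hs2.mul_left _).tsum_sub (hbsS.mul_left _),
      ← ((hs2.mul_left _).sub (hbsS.mul_left _)).tsum_add hs2S,
      ← (((hs2.mul_left _).sub (hbsS.mul_left _)).add hs2S).tsum_add hnb,
      ← ((((hs2.mul_left _).sub (hbsS.mul_left _)).add hs2S).add hnb).tsum_sub hsS]
    refine tsum_congr fun j => ?_
    simp only [hs]; ring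
  have hval : ∑ j ∈ κ.support, bj j * (m j : ℝ) = n * S - ∑' j, bj j * s j := by
    rw [← tsum_eq_sum (f := fun j => bj j * (m j : ℝ)) (L := .unconditional ℕ)
      fun j hj => by simp [hm0 hj]]
    have := (hs2.hasSum.mul_left (n : ℝ)).sub hbsS.hasSum
    rw [← this.tsum_eq]
    refine tsum_congr fun j => ?_
    simp only [hs]; ring
  have hdr : (d : ℝ) = n * b - r := by rw [hr]; ring
  have hDreal : (2 * D : ℝ) = (n * b - r) ^ 2 + 3 * (n * b - r) := by
    rw [← hdr]; exact_mod_cast hD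
  have hdiff : (2 * D - 2 * K : ℝ) = n ^ 2 * V - 2 * n * L + n * (3 * b - P)
      + (r ^ 2 - 3 * r + (∑' j, s j - ∑' j, s j ^ 2)) := by
    rw [hDreal, hKreal, hL, hV]; ring
  have hrem : -3 ≤ r ^ 2 - 3 * r + (∑' j, s j - ∑' j, s j ^ 2) := by
    have : -3 ≤ r ^ 2 - 3 * r := by nlinarith
    linarith
  have hge : (N : ℝ) + K ≤ D := by
    have h1 : -|3 * b - P| ≤ 3 * b - P := neg_abs_le _
    have h2 : L ≤ b + P := (le_abs_self _).trans hLabs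
    have h3 : 0 ≤ n * V - 2 * L + (3 * b - P) - (3 + 2 * N) := by linarith
    have h4 : (3 + 2 * N : ℝ) ≤ n * (n * V - 2 * L + (3 * b - P)) := by
      have : (0 : ℝ) ≤ N := by positivity
      exact (sub_nonneg.1 h3).trans (le_mul_of_one_le_left (by linarith) hn1')
    have h6 : n * (n * V - 2 * L + (3 * b - P)) =
        n ^ 2 * V - 2 * n * L + n * (3 * b - P) := by ring
    linarith
  have hge' : N + K ≤ D := by exact_mod_cast hge
  refine ⟨D - K, Nat.le_sub_of_add_le hge', ?_⟩
  have hkcast : ((D - K : ℕ) : ℝ) = D - K := Nat.cast_sub (by omega)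
  have hcap : toricCap b bj (D - K) ≤ n * V - L := by
    have := toricCap_le hb hnonneg hs2 hsq hκ (k := D - K) (d := d)
      (by rw [← hD, ← hK, Nat.sub_add_cancel (by omega)])
    rw [hval, hdr] at this
    refine this.trans (le_of_eq ?_)
    rw [hL, hV]; ring
  have hsqrt : n * V - L + ((3 * b - P) / 2 - ε) ≤ √(2 * (D - K : ℕ) * V) := by
    apply Real.le_sqrt_of_sq_le
    rw [hkcast, mul_sub 2 (D : ℝ), hdiff]
    exact sq_le_mul_of_le hV0.le hLabs hrem hnε
  linarith

/-- `liminf (c_k − √(2k·Vol)) ≤ −Per/2` where `Vol = b² − ∑ bj²`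
and `Per = 3b − ∑ bj`. -/
theorem stmt_4 (b : ℝ) (hb : 0 < b) (bj : ℕ → ℝ)
    (hnonneg : ∀ j, 0 ≤ bj j) (hmono : Antitone bj) (hsum : Summable bj)
    (h12 : bj 0 + bj 1 ≤ b) (h3b : ∑' j, bj j ≤ 3 * b)
    (hsq : ∑' j, (bj j) ^ 2 < b ^ 2) :
    Filter.liminf
        (fun k : ℕ => toricCap b bj k -
          Real.sqrt (2 * k * (b ^ 2 - ∑' j, (bj j) ^ 2)))
        Filter.atTop
      ≤ -(3 * b - ∑' j, bj j) / 2 := by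
  have hs2 : Summable fun j => bj j ^ 2 :=
    (hsum.mul_left (bj 0)).of_nonneg_of_le (fun j => sq_nonneg _) fun j => by
      rw [sq]
      exact mul_le_mul_of_nonneg_right (hmono (Nat.zero_le j)) (hnonneg j)
  refine le_of_forall_pos_le_add fun ε hε => liminf_le_of_frequently_le ?_ ?_
  · exact frequently_atTop.2 fun N => exists_toricCap_sub_sqrt_le hb hnonneg hsum hs2 hsq hε N
  · refine isBoundedUnder_of ⟨-(3 / 2 * b), fun k => ?_⟩
    have : √(2 * k * (b ^ 2 - ∑' j, bj j ^ 2)) - 3 / 2 * b ≤ toricCap b bj k :=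
      le_ciInf fun κ => sqrt_vol_sub_le hb hnonneg hs2 hsq k κ
    simp only [ge_iff_le]
    linarith
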